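/- Let K = [[0,1],[−1,0]], γ = 1 − 1/√2, let T > 0, σ > 0, τ > 0, s > 0, κ > 0, C_b > 0 and b₀ ≠ 0. Then there exist constants C > 0 and λ₀ > 0 such that the following holds. Let ε ∈ (0,1], Δt > 0 and N ∈ ℕ satisfy NΔt = T and Δt/ε² ≥ λ₀; set δ = Δt/ε and λ = Δt/ε². Let E : ℝ² → ℝ² satisfy |E(y)| ≤ κ and |E(y) − E(y′)| ≤ κ|y − y′| for all y, y′, and let b̃ : ℝ² → ℝ satisfy |b̃(z) − b₀| ≤ C_b ε^s for all z ∈ ℝ². Let ξ₀, …, ξ_{N−1} ∈ ℝ² and set M_ξ = max_{0 ≤ n < N} |ξₙ|. Given x⁰, v⁰ ∈ ℝ², define (xⁿ, vⁿ) by the APSI2 recursion: with M_γ(y) = ((1+γδ/τ)I₂ + γλ b̃(εy)K)/((1+γδ/τ)² + (γλ b̃(εy))²), set vₙ⁽¹⁾ = M_γ(xⁿ)(vⁿ + γδE(xⁿ)), xₙ⁽²⁾ = xⁿ + (δ/(2γ))vₙ⁽¹⁾, Fₙ⁽¹⁾ = E(xⁿ) + (b̃(εxⁿ)/ε)K vₙ⁽¹⁾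 − vₙ⁽¹⁾/τ, vⁿ⁺¹ = M_γ(xₙ⁽²⁾)( vⁿ + (1−γ)δFₙ⁽¹⁾ + γδE(xₙ⁽²⁾) + √(2σδ/τ) ξₙ ), xⁿ⁺¹ = xⁿ + (1−γ)δvₙ⁽¹⁾ + γδvⁿ⁺¹. Define uⁿ by u⁰ = x⁰ and uⁿ⁺¹ = uⁿ + (1−γ)Δt (K/b₀)E(uⁿ) + γΔt (K/b₀)E(u⁽¹⁾), where u⁽¹⁾ = uⁿ + (Δt/(2γ))(K/b₀)E(uⁿ). Then, with R(y) = (b̃(εy)τ²K + ετI₂)/((b̃(εy)τ)² + ε²), one has ‖x^N − u^N‖ ≤ C [ ε² (1 + ‖ε⁻¹v⁰ − R(x⁰)E(x⁰)‖) + M_ξ √(2σε/(τΔt)) + (ε^s τ² + ε² + ετ)/(ε² + τ²) ]. -/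

import Mathlib

/-- Euclidean norm on `ℝ²` (realized as `Fin 2 → ℝ`). -/
noncomputable def enorm2 (w : Fin 2 → ℝ) : ℝ := Real.sqrt (∑ i : Fin 2, w i ^ 2)

/-- The identification of the plane with `ℂ` under which the rotation `K` becomes `-I`. -/
noncomputable def planeToComplex : (Fin 2 → ℝ) ≃ₗ[ℝ] ℂ := Complex.basisOneI.equivFun.symm

theorem planeToComplex_apply (w : Fin 2 → ℝ) :
    planeToComplex w = (w 0 : ℂ) + (w 1 : ℂ) * Complex.I := by
  simp [planeToComplex, Module.Basis.equivFun_symm_apply, Complex.coe_basisOneI]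

theorem norm_planeToComplex (w : Fin 2 → ℝ) : ‖planeToComplex w‖ = enorm2 w := by
  rw [planeToComplex_apply, Complex.norm_add_mul_I, enorm2, Fin.sum_univ_two]

theorem planeToComplex_rotation (w : Fin 2 → ℝ) :
    planeToComplex ((!![0, 1; -1, 0] : Matrix (Fin 2) (Fin 2) ℝ).mulVec w)
      = -Complex.I * planeToComplex w := by
  simp only [planeToComplex_apply, Matrix.mulVec, dotProduct, Fin.sum_univ_two]
  simp
  linear_combination (w 1 : ℂ) * Complex.I_sq

theorem planeToComplex_inv_smul_mulVec {a b : ℝ} (hab : a ^ 2 + b ^ 2 ≠ 0) (t : ℝ)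
    (w : Fin 2 → ℝ) :
    planeToComplex (((a ^ 2 + b ^ 2)⁻¹ • ((t * a) • (1 : Matrix (Fin 2) (Fin 2) ℝ)
      + (t * b) • !![0, 1; -1, 0])).mulVec w) = t / (a + b * Complex.I) * planeToComplex w := by
  simp only [Matrix.smul_mulVec, Matrix.add_mulVec, Matrix.one_mulVec, map_smul, map_add,
    planeToComplex_rotation, Complex.real_smul]
  have h0 : (a : ℂ) ^ 2 + (b : ℂ) ^ 2 ≠ 0 := by exact_mod_cast hab
  have h1 : (a : ℂ) + b * Complex.I ≠ 0 := by
    intro h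
    apply h0
    linear_combination (a - b * Complex.I) * h + (b : ℂ) ^ 2 * Complex.I_sq
  push_cast
  field_simp
  linear_combination -((b : ℂ) ^ 2 * planeToComplex w * t) * Complex.I_sq

theorem first_stage_eq {M L R ε δ γ V E : ℂ} (hε : ε ≠ 0) (hM : M * (1 - γ * L) = 1)
    (hL : L * (ε * R) = -δ) :
    M * (V + γ * δ * E) = ε * (R * E + M * (V / ε - R * E)) := by
  field_simp
  linear_combination (ε * R * E) * hM + (γ * M * E) * hL

theorem second_stage_eq {M' L L' R R' ε δ γ V E E' p Z : ℂ} (hε : ε ≠ 0)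
    (hM' : M' * (1 - γ * L') = 1) (hL : L * (ε * R) = -δ) (hL' : L' * (ε * R') = -δ) :
    M' * (V + (1 - γ) * (δ * E + L * (ε * (R * E + p))) + γ * δ * E' + Z)
      = ε * (R' * E' + M' * ((V / ε - R * E) + (1 - γ) * L * p + (R * E - R' * E') + Z / ε)) := by
  field_simp
  linear_combination (ε * R' * E') * hM' + (γ * M' * E') * hL' + M' * (1 - γ) * E * hL

theorem norm_resolvent_le {d γ lam b β : ℝ} (hd : 0 ≤ d) (hγ : 1 / 4 ≤ γ) (hlam : 0 < lam)
    (hβ : 0 < β) (hb : β / 2 ≤ |b|) :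
    ‖((1 : ℂ) / (((1 + γ * d : ℝ) : ℂ) + ((γ * lam * b : ℝ) : ℂ) * Complex.I))‖ ≤ 1 ∧
    ‖((1 : ℂ) / (((1 + γ * d : ℝ) : ℂ) + ((γ * lam * b : ℝ) : ℂ) * Complex.I))‖
      ≤ 8 / β * lam⁻¹ := by
  set z : ℂ := ((1 + γ * d : ℝ) : ℂ) + ((γ * lam * b : ℝ) : ℂ) * Complex.I with hz
  have hre : z.re = 1 + γ * d := by simp [hz]
  have him : z.im = γ * lam * b := by simp [hz]
  have h1 : 1 ≤ ‖z‖ := by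
    refine le_trans ?_ (Complex.re_le_norm z)
    rw [hre]; nlinarith
  have h2 : β * lam / 8 ≤ ‖z‖ := by
    refine le_trans ?_ (Complex.abs_im_le_norm z)
    rw [him, abs_mul, abs_of_pos (by positivity)]
    calc β * lam / 8 = 1 / 4 * lam * (β / 2) := by ring
      _ ≤ _ := by gcongr
  rw [norm_div, norm_one]
  constructor
  · rw [div_le_one (by linarith)]; exact h1
  · calc 1 / ‖z‖ ≤ 1 / (β * lam / 8) := by gcongr
      _ = _ := by field_simp

theorem norm_drift_le {ε τ b β : ℝ} (hτ : 0 < τ) (hβ : 0 < β) (hb : β / 2 ≤ |b|) :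
    ‖(τ : ℂ) / ((ε : ℂ) + ((b * τ : ℝ) : ℂ) * Complex.I)‖ ≤ 2 / β := by
  have h2 : β / 2 * τ ≤ ‖(ε : ℂ) + ((b * τ : ℝ) : ℂ) * Complex.I‖ := by
    refine le_trans ?_ (Complex.abs_im_le_norm _)
    simp only [Complex.add_im, Complex.ofReal_im, Complex.im_ofReal_mul,
      Complex.I_im, mul_one, zero_add, abs_mul, abs_of_pos hτ]
    gcongr
  rw [norm_div, Complex.norm_real, Real.norm_of_nonneg hτ.le]
  calc _ ≤ τ / (β / 2 * τ) := by gcongr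
    _ = _ := by field_simp

theorem norm_drift_sub_le {ε τ b b₀ Cb p : ℝ} (hε : 0 < ε) (hτ : 0 < τ) (hCb : 0 < Cb)
    (hp : 0 < p) (hb₀ : b₀ ≠ 0) (hb : |b₀| / 2 ≤ |b|) (hbb : |b - b₀| ≤ Cb * p) (hε1 : ε ≤ 1) :
    ‖(τ : ℂ) / ((ε : ℂ) + ((b * τ : ℝ) : ℂ) * Complex.I) - -Complex.I / b₀‖
      ≤ 2 / b₀ ^ 2 * (1 + Cb) * (1 + τ ^ 2) / τ ^ 2
        * ((p * τ ^ 2 + ε ^ 2 + ε * τ) / (ε ^ 2 + τ ^ 2)) := by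
  set w := (ε : ℂ) + ((b * τ : ℝ) : ℂ) * Complex.I with hw
  have hw0 : w ≠ 0 := by
    intro h
    have := congrArg Complex.re h
    simp [hw] at this; linarith
  have hβ : 0 < |b₀| := abs_pos.mpr hb₀
  have hb₀' : (b₀ : ℂ) ≠ 0 := by exact_mod_cast hb₀
  have hid : (τ : ℂ) / w - -Complex.I / b₀
      = (τ / w) * ((ε * Complex.I - ((b - b₀) * τ : ℝ)) / (b₀ * τ)) := by
    have hτ' : (τ : ℂ) ≠ 0 := by exact_mod_cast hτ.ne'
    field_simp
    rw [hw]
    push_cast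
    linear_combination (b * τ : ℂ) * Complex.I_sq
  have hnum : ‖(ε : ℂ) * Complex.I - ((b - b₀) * τ : ℝ)‖ ≤ (1 + Cb) * (ε + p * τ) := by
    refine (norm_sub_le _ _).trans ?_
    rw [norm_mul, Complex.norm_I, Complex.norm_real, Complex.norm_real, Real.norm_of_nonneg hε.le,
      norm_mul, Real.norm_eq_abs, Real.norm_of_nonneg hτ.le]
    have : |b - b₀| * τ ≤ Cb * p * τ := by gcongr
    have : 0 ≤ p * τ + Cb * ε := by positivity
    nlinarith
  have hρ : τ * (ε + p * τ) / (1 + τ ^ 2)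
      ≤ (p * τ ^ 2 + ε ^ 2 + ε * τ) / (ε ^ 2 + τ ^ 2) := by
    gcongr
    · nlinarith [sq_nonneg ε]
    · nlinarith
  rw [hid, norm_mul, norm_div _ ((b₀ : ℂ) * τ), norm_mul (b₀ : ℂ), Complex.norm_real, Complex.norm_real,
    Real.norm_of_nonneg hτ.le, Real.norm_eq_abs]
  calc _ ≤ 2 / |b₀| * ((1 + Cb) * (ε + p * τ) / (|b₀| * τ)) := by
        gcongr
        exact norm_drift_le hτ hβ hb
    _ = 2 / b₀ ^ 2 * (1 + Cb) * (1 + τ ^ 2) / τ ^ 2 * (τ * (ε + p * τ) / (1 + τ ^ 2)) := by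
        rw [← sq_abs b₀]; field_simp
    _ ≤ _ := by gcongr
section
variable {V : Type*} [NormedAddCommGroup V]

theorem norm_sub_le_of_near_lipschitz {c ρ : ℝ} {D f : V → V}
    (hDf : ∀ y, ‖D y - f y‖ ≤ c * ρ) (hf : ∀ y z, ‖f y - f z‖ ≤ c * ‖y - z‖) (y z : V) :
    ‖D y - D z‖ ≤ 2 * c * ρ + c * ‖y - z‖ := by
  have h : D y - D z = (D y - f y) + (f y - f z) - (D z - f z) := by abel
  rw [h]
  have h1 := norm_sub_le ((D y - f y) + (f y - f z)) (D z - f z)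
  have h2 := norm_add_le (D y - f y) (f y - f z)
  linarith [hDf y, hDf z, hf y z]

theorem norm_sub_map_le_of_near_lipschitz {c ρ : ℝ} {D f : V → V}
    (hDf : ∀ y, ‖D y - f y‖ ≤ c * ρ) (hf : ∀ y z, ‖f y - f z‖ ≤ c * ‖y - z‖) (y z : V) :
    ‖D y - f z‖ ≤ c * ρ + c * ‖y - z‖ := by
  have h2 := norm_add_le (D y - f y) (f y - f z)
  rw [sub_add_sub_cancel] at h2
  linarith [hDf y, hf y z]

variable [NormedSpace ℝ V]

theorem norm_smul_le_of_le {t b : ℝ} {w : V} (ht : 0 ≤ t) (hw : ‖w‖ ≤ b) : ‖t • w‖ ≤ t * b := by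
  rw [norm_smul, Real.norm_of_nonneg ht]
  exact mul_le_mul_of_nonneg_left hw ht

theorem stage_defect_le {c q a ρ h η d σ : ℝ} (hc : 1 ≤ c) (hq : 0 ≤ q) (hq1 : q ≤ 1)
    (ha : 0 ≤ a) (hρ : 0 ≤ ρ) (hh : 0 ≤ h) (hhc : h ≤ c) (hη : 0 ≤ η)
    (hd : d ≤ c * h * (c + c * q * a))
    (hσ : σ ≤ c * q * (c * a + (2 * c * ρ + c * d)) + c * η) :
    σ ≤ 2 * c ^ 5 * (q * a + q * ρ + q * h + η) := by
  have hc0 : 0 ≤ c := by linarith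
  have p1 : c ≤ c ^ 5 := by simpa using pow_le_pow_right₀ hc (show 1 ≤ 5 by norm_num)
  have p2 : c ^ 2 ≤ c ^ 5 := pow_le_pow_right₀ hc (by norm_num)
  have p4 : c ^ 4 ≤ c ^ 5 := pow_le_pow_right₀ hc (by norm_num)
  have e1 : h * (q * a) ≤ c * a := by
    have : q * a ≤ a := by nlinarith
    gcongr
  have e2 : c * d ≤ c ^ 3 * h + c ^ 4 * a := by
    calc c * d ≤ c * (c * h * (c + c * q * a)) := by gcongr
      _ = c ^ 3 * h + c ^ 3 * (h * (q * a)) := by ring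
      _ ≤ c ^ 3 * h + c ^ 3 * (c * a) := by gcongr
      _ = _ := by ring
  calc σ ≤ c * q * (c * a + (2 * c * ρ + c * d)) + c * η := hσ
    _ ≤ c * q * (c * a + (2 * c * ρ + (c ^ 3 * h + c ^ 4 * a))) + c * η := by gcongr
    _ = c ^ 2 * (q * a) + 2 * c ^ 2 * (q * ρ) + c ^ 4 * (q * h) + c ^ 5 * (q * a) + c * η := by
      ring
    _ ≤ c ^ 5 * (q * a) + 2 * c ^ 5 * (q * ρ) + c ^ 5 * (q * h) + c ^ 5 * (q * a) + c ^ 5 * η := by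
      gcongr
    _ ≤ _ := by
      have : 0 ≤ c ^ 5 * (q * h) := by positivity
      have : 0 ≤ c ^ 5 * η := by positivity
      nlinarith

theorem perturbed_step_le {c h q ρ η γ : ℝ} (hc : 2 ≤ c) (hh : 0 ≤ h) (hhc : h ≤ c)
    (hq : 0 ≤ q) (hq1 : q ≤ 1) (hρ : 0 ≤ ρ) (hη : 0 ≤ η) (hγ : 1 / 4 ≤ γ) (hγ1 : γ ≤ 1)
    {D f : V → V} (hDf : ∀ y, ‖D y - f y‖ ≤ c * ρ) (hf : ∀ y z, ‖f y - f z‖ ≤ c * ‖y - z‖)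
    (hD : ∀ y, ‖D y‖ ≤ c) {x x' y r r' p s u u' w : V} (hp : ‖p‖ ≤ c * q * ‖r‖)
    (hs : ‖s‖ ≤ c * q * (c * ‖r‖ + ‖D x - D y‖) + c * η)
    (hy : y = x + (h / (2 * γ)) • (D x + p))
    (hx' : x' = x + ((1 - γ) * h) • (D x + p) + (γ * h) • (D y + s))
    (hr' : r' = s + (D y - D x'))
    (hw : w = u + (h / (2 * γ)) • f u)
    (hu' : u' = u + ((1 - γ) * h) • f u + (γ * h) • f w) :
    ‖r'‖ ≤ 10 * c ^ 7 * (q * ‖r‖ + (ρ + h + η)) ∧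
      ‖x' - u'‖ ≤ (1 + 10 * c ^ 5 * h) * ‖x - u‖
        + 10 * c ^ 5 * h * (q * ‖r‖ + (ρ + q * h + η)) := by
  have hc0 : 0 ≤ c := by linarith
  have hc1 : 1 ≤ c := by linarith
  have hγ0 : 0 < γ := by linarith
  have ha := norm_nonneg r
  set a := ‖r‖ with ha'
  have hg0 : 0 ≤ h / (2 * γ) := by positivity
  have hg : h / (2 * γ) ≤ c * h := by
    rw [div_le_iff₀ (by positivity)]
    nlinarith [mul_nonneg hh (show 0 ≤ c * γ - 1 / 2 by nlinarith)]
  have hDp : ∀ z, ‖D z + p‖ ≤ c + c * q * a := fun z =>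
    (norm_add_le _ _).trans (add_le_add (hD z) hp)
  have hxy : ‖x - y‖ ≤ c * h * (c + c * q * a) := by
    rw [norm_sub_rev, hy, add_sub_cancel_left]
    exact (norm_smul_le_of_le hg0 (hDp x)).trans (by gcongr)
  have hS : ‖s‖ ≤ 2 * c ^ 5 * (q * a + q * ρ + q * h + η) := by
    refine stage_defect_le hc1 hq hq1 ha hρ hh hhc hη hxy (hs.trans ?_)
    gcongr
    exact norm_sub_le_of_near_lipschitz hDf hf x y
  have k1 : (1 - γ) * h ≤ h := by nlinarith
  have k1' : 0 ≤ (1 - γ) * h := mul_nonneg (by linarith) hh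
  have k2 : γ * h ≤ h := by nlinarith
  have k2' : 0 ≤ γ * h := by positivity
  have p3 : c ^ 3 ≤ c ^ 7 := pow_le_pow_right₀ hc1 (by norm_num)
  have p4 : c ^ 4 ≤ c ^ 7 := pow_le_pow_right₀ hc1 (by norm_num)
  have p2 : c ^ 2 ≤ c ^ 7 := pow_le_pow_right₀ hc1 (by norm_num)
  have p1 : c ≤ c ^ 7 := by simpa using pow_le_pow_right₀ hc1 (show 1 ≤ 7 by norm_num)
  have p15 : c ≤ c ^ 5 := by simpa using pow_le_pow_right₀ hc1 (show 1 ≤ 5 by norm_num)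
  have p45 : c ^ 4 ≤ c ^ 5 := pow_le_pow_right₀ hc1 (by norm_num)
  have hqa : 0 ≤ q * a := by positivity
  have hqh : q * h ≤ h := by nlinarith
  have hqρ : q * ρ ≤ ρ := by nlinarith
  constructor
  · have hyx' : ‖y - x'‖ ≤ c * h * (c + c * q * a) + (h * (c + c * q * a) + h * (c + ‖s‖)) := by
      have e : y - x' = (y - x) - (((1 - γ) * h) • (D x + p) + (γ * h) • (D y + s)) := by
        rw [hx']; abel
      rw [e]
      refine (norm_sub_le _ _).trans (add_le_add (by rwa [norm_sub_rev]) ?_)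
      refine (norm_add_le _ _).trans (add_le_add ?_ ?_)
      · exact (norm_smul_le_of_le k1' (hDp x)).trans (by gcongr)
      · refine (norm_smul_le_of_le k2'
          ((norm_add_le _ _).trans (add_le_add_left (hD y) _))).trans (by gcongr)
    set S := q * a + (ρ + h + η) with hSdef
    have hS' : ‖s‖ ≤ 2 * c ^ 5 * S := by
      refine hS.trans ?_
      gcongr
      linarith
    have hS0 : 0 ≤ S := by positivity
    have l1 : ρ ≤ S := by linarith
    have l2 : h ≤ S := by linarith
    have l3 : q * a ≤ S := by linarith
    calc ‖r'‖ ≤ ‖s‖ + ‖D y - D x'‖ := hr' ▸ norm_add_le _ _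
      _ ≤ ‖s‖ + (2 * c * ρ + c * ‖y - x'‖) := by
        gcongr; exact norm_sub_le_of_near_lipschitz hDf hf y x'
      _ ≤ ‖s‖ + (2 * c * ρ + c * (c * h * (c + c * q * a)
            + (h * (c + c * q * a) + h * (c + ‖s‖)))) := by gcongr
      _ = ‖s‖ + 2 * c * ρ + (c ^ 3 + 2 * c ^ 2) * h + (c ^ 3 + c ^ 2) * h * (q * a)
            + c * h * ‖s‖ := by ring
      _ ≤ 2 * c ^ 5 * S + 2 * c * S + (c ^ 3 + 2 * c ^ 2) * S + (c ^ 3 + c ^ 2) * c * S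
            + c * c * (2 * c ^ 5 * S) := by gcongr
      _ = (2 * c ^ 5 + 2 * c + 2 * c ^ 3 + 2 * c ^ 2 + c ^ 4 + 2 * c ^ 7) * S := by ring
      _ ≤ _ := by
        gcongr
        have p7 : 2 * c ^ 5 ≤ c ^ 7 :=
          calc 2 * c ^ 5 ≤ c ^ 2 * c ^ 5 := by gcongr; nlinarith only [hc]
            _ = c ^ 7 := by ring
        linarith only [p7, p1, p2, p3, p4]
  · set e := ‖x - u‖ with he
    have he0 : 0 ≤ e := norm_nonneg _
    set m := c * ρ + c * e + c * q * a with hm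
    have hm0 : 0 ≤ m := by positivity
    have hm1 : ‖D x + p - f u‖ ≤ m := by
      have : D x + p - f u = (D x - f u) + p := by abel
      rw [this]
      exact (norm_add_le _ _).trans
        (add_le_add (norm_sub_map_le_of_near_lipschitz hDf hf x u) hp)
    have hyw : ‖y - w‖ ≤ e + c * h * m := by
      have : y - w = (x - u) + (h / (2 * γ)) • (D x + p - f u) := by
        rw [hy, hw]; module
      rw [this]
      refine (norm_add_le _ _).trans (add_le_add_right ?_ _)
      exact (norm_smul_le_of_le hg0 hm1).trans (by gcongr)
    have hm2 : ‖D y + s - f w‖ ≤ c * ρ + c * (e + c * h * m) + ‖s‖ := by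
      have : D y + s - f w = (D y - f w) + s := by abel
      rw [this]
      refine (norm_add_le _ _).trans (add_le_add_left ?_ _)
      refine (norm_sub_map_le_of_near_lipschitz hDf hf y w).trans (by gcongr)
    have hxu : x' - u' = (x - u) + ((1 - γ) * h) • (D x + p - f u)
        + (γ * h) • (D y + s - f w) := by
      rw [hx', hu']; module
    set S := q * a + (ρ + q * h + η) with hSdef
    have hS' : ‖s‖ ≤ 2 * c ^ 5 * S := by
      refine hS.trans ?_
      gcongr
      linarith
    have hqh0 : 0 ≤ q * h := by positivity
    have hS0 : 0 ≤ S := by positivity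
    have l1 : ρ ≤ S := by linarith
    have hmS : m ≤ c * (e + S) := by
      have : c * (ρ + e + q * a) ≤ c * (e + S) :=
        mul_le_mul_of_nonneg_left (by linarith) hc0
      linarith
    calc ‖x' - u'‖ ≤ e + h * m + h * (c * ρ + c * (e + c * h * m) + ‖s‖) := by
          rw [hxu]
          refine (norm_add_le _ _).trans (add_le_add ((norm_add_le _ _).trans
            (add_le_add_right ?_ _)) ?_)
          · exact (norm_smul_le_of_le k1' hm1).trans (by gcongr)
          · exact (norm_smul_le_of_le k2' hm2).trans (by gcongr)
      _ ≤ e + h * (c * (e + S)) + h * (c * S + c * (e + c * c * (c * (e + S)))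
            + 2 * c ^ 5 * S) := by gcongr
      _ = e + h * ((2 * c + c ^ 4) * (e + S) + 2 * c ^ 5 * S) := by ring
      _ ≤ e + h * ((2 * c ^ 5 + c ^ 5) * (e + S) + 2 * c ^ 5 * S) := by gcongr
      _ = (1 + 3 * c ^ 5 * h) * e + 5 * c ^ 5 * h * S := by ring
      _ ≤ _ := by gcongr <;> norm_num

end

theorem sum_le_of_contracting_recursion {a : ℕ → ℝ} {q A W : ℝ} {N : ℕ}
    (ha : ∀ n, 0 ≤ a n) (hA : A * q ≤ 1 / 2)
    (h : ∀ n < N, a (n + 1) ≤ A * (q * a n + W)) :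
    ∑ n ∈ Finset.range N, a n ≤ 2 * a 0 + 2 * N * (A * W) := by
  have key : ∀ n ≤ N, ∑ k ∈ Finset.range n, a k + 2 * a n ≤ 2 * a 0 + 2 * n * (A * W) := by
    intro n
    induction n with
    | zero => intro; simp
    | succ n ih =>
      intro hn
      have h1 := ih (by omega)
      have h2 := h n (by omega)
      have h3 : A * q * a n ≤ 1 / 2 * a n := mul_le_mul_of_nonneg_right hA (ha n)
      rw [Finset.sum_range_succ]
      push_cast
      linarith
  linarith [key N le_rfl, ha N]

theorem discrete_gronwall_exp {e g : ℕ → ℝ} {B : ℝ} {N : ℕ} (hB : 0 ≤ B) (hg : ∀ n, 0 ≤ g n)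
    (he0 : e 0 = 0) (h : ∀ n < N, e (n + 1) ≤ (1 + B) * e n + g n) :
    e N ≤ Real.exp (B * N) * ∑ n ∈ Finset.range N, g n := by
  have key : ∀ n ≤ N, e n ≤ Real.exp (B * n) * ∑ k ∈ Finset.range n, g k := by
    intro n
    induction n with
    | zero => intro; simp [he0]
    | succ n ih =>
      intro hn
      have h1 := ih (by omega)
      have h2 := h n (by omega)
      have h3 : 1 + B ≤ Real.exp B := by linarith [Real.add_one_le_exp B]
      have h4 : 1 ≤ Real.exp (B * (n + 1 : ℕ)) := Real.one_le_exp (by positivity)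
      have h5 : Real.exp (B * (n + 1 : ℕ)) = Real.exp B * Real.exp (B * n) := by
        rw [← Real.exp_add]; push_cast; ring_nf
      have hs : 0 ≤ ∑ k ∈ Finset.range n, g k := Finset.sum_nonneg fun k _ => hg k
      rw [Finset.sum_range_succ, mul_add]
      calc e (n + 1) ≤ (1 + B) * e n + g n := h2
        _ ≤ Real.exp B * (Real.exp (B * n) * ∑ k ∈ Finset.range n, g k) + 1 * g n := by
          rw [one_mul]
          gcongr ?_ + _
          calc (1 + B) * e n ≤ (1 + B) * (Real.exp (B * n) * ∑ k ∈ Finset.range n, g k) := by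
                gcongr
            _ ≤ _ := by gcongr
        _ ≤ Real.exp (B * (n + 1 : ℕ)) * ∑ k ∈ Finset.range n, g k
            + Real.exp (B * (n + 1 : ℕ)) * g n := by
          rw [h5, mul_assoc, ← h5]
          gcongr
          exact hg n
  exact key N le_rfl

theorem perturbed_two_stage_bound {V : Type*} [NormedAddCommGroup V] [NormedSpace ℝ V]
    {c h q ρ η γ T : ℝ} {N : ℕ} (hc : 2 ≤ c) (hh : 0 ≤ h) (hhc : h ≤ c)
    (hq : 0 ≤ q) (hq1 : q ≤ 1) (hρ : 0 ≤ ρ) (hη : 0 ≤ η) (hγ : 1 / 4 ≤ γ) (hγ1 : γ ≤ 1)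
    (hT : N * h = T) (hcq : 10 * c ^ 7 * q ≤ 1 / 2)
    {D f : V → V} (hDf : ∀ y, ‖D y - f y‖ ≤ c * ρ) (hf : ∀ y z, ‖f y - f z‖ ≤ c * ‖y - z‖)
    (hD : ∀ y, ‖D y‖ ≤ c) {x y r p s u w : ℕ → V} (hp : ∀ n, ‖p n‖ ≤ c * q * ‖r n‖)
    (hs : ∀ n < N, ‖s n‖ ≤ c * q * (c * ‖r n‖ + ‖D (x n) - D (y n)‖) + c * η)
    (hy : ∀ n, y n = x n + (h / (2 * γ)) • (D (x n) + p n))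
    (hx : ∀ n, x (n + 1) = x n + ((1 - γ) * h) • (D (x n) + p n) + (γ * h) • (D (y n) + s n))
    (hr : ∀ n, r (n + 1) = s n + (D (y n) - D (x (n + 1))))
    (hw : ∀ n, w n = u n + (h / (2 * γ)) • f (u n))
    (hu : ∀ n, u (n + 1) = u n + ((1 - γ) * h) • f (u n) + (γ * h) • f (w n))
    (h0 : x 0 = u 0) :
    ‖x N - u N‖ ≤ Real.exp (10 * c ^ 5 * T) * (10 * c ^ 5) * (2 + 20 * c ^ 7 * T + T)
      * (q * h * (1 + ‖r 0‖) + η + ρ) := by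
  have hc0 : 0 ≤ c := by linarith
  have hT0 : 0 ≤ T := hT ▸ by positivity
  have step := fun n (hn : n < N) => perturbed_step_le hc hh hhc hq hq1 hρ hη hγ hγ1 hDf hf hD
    (hp n) (hs n hn) (hy n) (hx n) (hr n) (hw n) (hu n)
  have hsum := sum_le_of_contracting_recursion (a := fun n => ‖r n‖) (fun n => norm_nonneg _) hcq
    (fun n hn => (step n hn).1)
  have hgr := discrete_gronwall_exp (e := fun n => ‖x n - u n‖) (B := 10 * c ^ 5 * h)
    (g := fun n => 10 * c ^ 5 * h * (q * ‖r n‖ + (ρ + q * h + η))) (N := N) (by positivity)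
    (fun n => by positivity) (by simp [h0]) (fun n hn => (step n hn).2)
  have hexp : 10 * c ^ 5 * h * N = 10 * c ^ 5 * T := by rw [← hT]; ring
  rw [hexp, ← Finset.mul_sum, Finset.sum_add_distrib, ← Finset.mul_sum] at hgr
  simp only [Finset.sum_const, Finset.card_range, nsmul_eq_mul] at hgr hsum
  refine hgr.trans ?_
  rw [mul_assoc (Real.exp _ * _), mul_assoc (Real.exp _)]
  rw [mul_assoc (10 * c ^ 5)]
  refine mul_le_mul_of_nonneg_left (mul_le_mul_of_nonneg_left ?_ (by positivity))
    (Real.exp_pos _).le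
  have e1 : h * (q * ∑ n ∈ Finset.range N, ‖r n‖)
      ≤ h * (q * (2 * ‖r 0‖ + 2 * N * (10 * c ^ 7 * (ρ + h + η)))) := by gcongr
  have e2 : h * (q * (2 * ‖r 0‖ + 2 * N * (10 * c ^ 7 * (ρ + h + η))))
      = 2 * (q * h * ‖r 0‖) + 20 * c ^ 7 * T * (q * (ρ + η) + q * h) := by rw [← hT]; ring
  have e3 : h * (N * (ρ + q * h + η)) = T * (ρ + q * h + η) := by rw [← hT]; ring
  have e4 : q * (ρ + η) ≤ ρ + η := mul_le_of_le_one_left (by positivity) hq1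
  have e5 : 20 * c ^ 7 * T * (q * (ρ + η) + q * h) ≤ 20 * c ^ 7 * T * ((ρ + η) + q * h) := by
    gcongr
  have t1 : 0 ≤ 20 * c ^ 7 * T * (q * h * ‖r 0‖) := by positivity
  have t2 : 0 ≤ T * (q * h * ‖r 0‖) := by positivity
  have t3 : 0 ≤ q * h := by positivity
  have t4 : 0 ≤ c ^ 7 * T * (ρ + η + q * h) := by positivity
  rw [mul_add, e3]
  linarith

theorem exists_pos_rpow_le {s Cb β : ℝ} (hs : 0 < s) (hCb : 0 < Cb) (hβ : 0 < β) :
    ∃ ε₀ > (0 : ℝ), ∀ ε, 0 < ε → ε ≤ ε₀ → Cb * ε ^ s ≤ β := by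
  refine ⟨(β / Cb) ^ s⁻¹, by positivity, fun ε hε h => ?_⟩
  have h1 : ε ^ s ≤ ((β / Cb) ^ s⁻¹) ^ s := by gcongr
  rw [Real.rpow_inv_rpow (by positivity) hs.ne'] at h1
  rwa [le_div_iff₀ hCb, mul_comm] at h1

theorem noise_scaling {ε Δt σ τ δ : ℝ} (hε : 0 < ε) (hΔ : 0 < Δt)
    (hδ : δ = Δt / ε) :
    (Δt / ε ^ 2)⁻¹ * (Real.sqrt (2 * σ * δ / τ) / ε) = Real.sqrt (2 * σ * ε / (τ * Δt)) := by
  have h : 2 * σ * ε / (τ * Δt) = (ε / Δt) ^ 2 * (2 * σ * δ / τ) := by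
    rw [hδ]; field_simp
  rw [h, Real.sqrt_mul (by positivity), Real.sqrt_sq (by positivity)]
  field_simp


set_option maxHeartbeats 1000000 in
/-- uniform estimate for the second-order semi-implicit scheme APSI2
(with stage weight `γ = 1 − 1/√2`): there are `C, λ₀ > 0` such that, whenever
`NΔt = T`, `Δt/ε² ≥ λ₀`, `E` is bounded and Lipschitz with constant `κ`,
`|b̃ − b₀| ≤ C_b ε^s` and `M_ξ` bounds the noises, the APSI2 iterates `xⁿ` and the
two-stage Runge–Kutta guiding-center iterates `uⁿ` satisfy
`‖x^N − u^N‖ ≤ C[ε²(1 + ‖ε⁻¹v⁰ − R(x⁰)E(x⁰)‖) + M_ξ√(2σε/(τΔt))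
  + (ε^sτ² + ε² + ετ)/(ε² + τ²)]`. -/
theorem stmt_18 (T σ τ s κ Cb b₀ : ℝ)
    (hT : 0 < T) (hσ : 0 < σ) (hτ : 0 < τ) (hs : 0 < s) (hκ : 0 < κ)
    (hCb : 0 < Cb) (hb₀ : b₀ ≠ 0)
    (K : Matrix (Fin 2) (Fin 2) ℝ) (hK : K = !![0, 1; -1, 0])
    (γ : ℝ) (hγ : γ = 1 - 1 / Real.sqrt 2) :
    ∃ C > (0 : ℝ), ∃ lam₀ > (0 : ℝ),
      ∀ (ε Δt : ℝ) (N : ℕ), ε ∈ Set.Ioc (0 : ℝ) 1 → 0 < Δt → (N : ℝ) * Δt = T →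
        lam₀ ≤ Δt / ε ^ 2 →
      ∀ δ lam : ℝ, δ = Δt / ε → lam = Δt / ε ^ 2 →
      ∀ (E : (Fin 2 → ℝ) → (Fin 2 → ℝ)) (btil : (Fin 2 → ℝ) → ℝ),
        (∀ y : Fin 2 → ℝ, enorm2 (E y) ≤ κ) →
        (∀ y y' : Fin 2 → ℝ, enorm2 (E y - E y') ≤ κ * enorm2 (y - y')) →
        (∀ z : Fin 2 → ℝ, |btil z - b₀| ≤ Cb * ε ^ s) →
      ∀ Mγ R : (Fin 2 → ℝ) → Matrix (Fin 2) (Fin 2) ℝ,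
        (∀ y : Fin 2 → ℝ,
          Mγ y = ((1 + γ * δ / τ) ^ 2 + (γ * lam * btil (ε • y)) ^ 2)⁻¹ •
            ((1 + γ * δ / τ) • (1 : Matrix (Fin 2) (Fin 2) ℝ)
              + (γ * lam * btil (ε • y)) • K)) →
        (∀ y : Fin 2 → ℝ,
          R y = ((btil (ε • y) * τ) ^ 2 + ε ^ 2)⁻¹ •
            ((btil (ε • y) * τ ^ 2) • K + (ε * τ) • (1 : Matrix (Fin 2) (Fin 2) ℝ))) →
      ∀ (ξ : ℕ → Fin 2 → ℝ) (Mξ : ℝ), (∀ n : ℕ, n < N → enorm2 (ξ n) ≤ Mξ) →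
      ∀ (x0 v0 : Fin 2 → ℝ) (x v v1 x2 F1 u u1 : ℕ → Fin 2 → ℝ),
        x 0 = x0 → v 0 = v0 → u 0 = x0 →
        (∀ n : ℕ, v1 n = (Mγ (x n)).mulVec (v n + (γ * δ) • E (x n))) →
        (∀ n : ℕ, x2 n = x n + (δ / (2 * γ)) • v1 n) →
        (∀ n : ℕ, F1 n = E (x n) + (btil (ε • x n) / ε) • K.mulVec (v1 n)
            - (1 / τ) • v1 n) →
        (∀ n : ℕ, v (n + 1) = (Mγ (x2 n)).mulVec
            (v n + ((1 - γ) * δ) • F1 n + (γ * δ) • E (x2 n)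
              + Real.sqrt (2 * σ * δ / τ) • ξ n)) →
        (∀ n : ℕ, x (n + 1) = x n + ((1 - γ) * δ) • v1 n + (γ * δ) • v (n + 1)) →
        (∀ n : ℕ, u1 n = u n + (Δt / (2 * γ)) • (b₀⁻¹ • K.mulVec (E (u n)))) →
        (∀ n : ℕ, u (n + 1) = u n + ((1 - γ) * Δt) • (b₀⁻¹ • K.mulVec (E (u n)))
            + (γ * Δt) • (b₀⁻¹ • K.mulVec (E (u1 n)))) →
        enorm2 (x N - u N)
          ≤ C * (ε ^ 2 * (1 + enorm2 (ε⁻¹ • v 0 - (R (x 0)).mulVec (E (x 0))))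
              + Mξ * Real.sqrt (2 * σ * ε / (τ * Δt))
              + (ε ^ s * τ ^ 2 + ε ^ 2 + ε * τ) / (ε ^ 2 + τ ^ 2)) := by
  subst hK
  have hβ : 0 < |b₀| := abs_pos.mpr hb₀
  have hsqrt : (4 / 3 : ℝ) ≤ Real.sqrt 2 := by
    apply Real.le_sqrt_of_sq_le; norm_num
  have hγ4 : 1 / 4 ≤ γ := by
    have : 1 / Real.sqrt 2 ≤ 1 / (4 / 3) := by gcongr
    rw [hγ]; linarith
  have hγ1 : γ ≤ 1 := by
    rw [hγ]
    have : 0 ≤ 1 / Real.sqrt 2 := by positivity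
    linarith
  have hγ0 : 0 < γ := by linarith
  obtain ⟨ε₀, hε₀, hsmall⟩ := exists_pos_rpow_le hs hCb (half_pos hβ)
  obtain ⟨Q, hQ⟩ : ∃ Q, Q = 2 / b₀ ^ 2 * (1 + Cb) * (1 + τ ^ 2) / τ ^ 2 := ⟨_, rfl⟩
  have hQ0 : 0 < Q := by rw [hQ]; positivity
  obtain ⟨c, hc⟩ : ∃ c, c = 9 + 8 / |b₀| + 2 / |b₀| * κ + Q * κ + T := ⟨_, rfl⟩
  have hc8 : 0 < 8 / |b₀| := by positivity
  have hc2κ : 0 < 2 / |b₀| * κ := by positivity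
  have hcQ : 0 < Q * κ := by positivity
  have hc9 : 9 ≤ c := by linarith
  have hc0 : 0 < c := by linarith
  refine ⟨Real.exp (10 * c ^ 5 * T) * (10 * c ^ 5) * (2 + 20 * c ^ 7 * T + T), by positivity,
    20 * c ^ 7 + T / ε₀ ^ 2, by positivity, ?_⟩
  intro ε Δt N hεI hΔ hN hlam₀ δ lam hδ hlam E btil hE hEL hb Mγ R hMγ hR ξ Mξ hξ x0 v0
    x v v1 x2 F1 u u1 hx0 hv0 hu0 hv1 hx2 hF1 hv hx hu1 hu
  obtain ⟨hε, hε1⟩ := hεI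
  have hN1 : 1 ≤ N := by
    rcases Nat.eq_zero_or_pos N with h | h
    · simp [h] at hN; linarith
    · exact h
  have hΔT : Δt ≤ T := by
    rw [← hN]
    exact le_mul_of_one_le_left hΔ.le (by exact_mod_cast hN1)
  have hMξ : 0 ≤ Mξ := (Real.sqrt_nonneg _).trans (hξ 0 (by omega))
  rw [← hlam] at hlam₀
  have hlam1 : 20 * c ^ 7 ≤ lam := le_trans (le_add_of_nonneg_right (by positivity)) hlam₀
  have hlam2 : T / ε₀ ^ 2 ≤ lam := le_trans (le_add_of_nonneg_left (by positivity)) hlam₀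
  have hc7 : 1 ≤ c ^ 7 := one_le_pow₀ (by linarith)
  have hlam0 : 0 < lam := by linarith
  have hεε₀ : ε ≤ ε₀ := by
    have h1 : T / ε₀ ^ 2 ≤ T / ε ^ 2 := hlam2.trans (by rw [hlam]; gcongr)
    have h2 : ε ^ 2 ≤ ε₀ ^ 2 := (div_le_div_iff_of_pos_left hT (by positivity) (by positivity)).1 h1
    exact le_of_sq_le_sq h2 hε₀.le
  have hbb : ∀ z, |b₀| / 2 ≤ |btil z| := by
    intro z
    have h1 := (hb z).trans (hsmall ε hε hεε₀)
    have h2 := abs_sub_abs_le_abs_sub b₀ (btil z)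
    rw [abs_sub_comm] at h2
    linarith
  have hδ0 : 0 < δ := by rw [hδ]; positivity
  have hεC : (ε : ℂ) ≠ 0 := by exact_mod_cast hε.ne'
  have hτC : (τ : ℂ) ≠ 0 := by exact_mod_cast hτ.ne'
  have hδlam : (δ : ℂ) = lam * ε := by
    rw [hδ, hlam]; push_cast; field_simp
  have hδε : (δ : ℂ) * ε = Δt := by
    rw [hδ]; push_cast; field_simp
  set ρ := (ε ^ s * τ ^ 2 + ε ^ 2 + ε * τ) / (ε ^ 2 + τ ^ 2) with hρ
  have hρ0 : 0 ≤ ρ := by positivity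
  set η := Mξ * Real.sqrt (2 * σ * ε / (τ * Δt)) with hη
  have hη0 : 0 ≤ η := by positivity
  let φ := planeToComplex
  let Rc : (Fin 2 → ℝ) → ℂ := fun y =>
    (τ : ℂ) / ((ε : ℂ) + ((btil (ε • y) * τ : ℝ) : ℂ) * Complex.I)
  let Mc : (Fin 2 → ℝ) → ℂ := fun y =>
    (1 : ℂ) / (((1 + γ * (δ / τ) : ℝ) : ℂ) + ((γ * lam * btil (ε • y) : ℝ) : ℂ) * Complex.I)
  let L : (Fin 2 → ℝ) → ℂ := fun y =>
    -((δ / τ : ℝ) : ℂ) - ((lam * btil (ε • y) : ℝ) : ℂ) * Complex.I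
  have hMφ : ∀ y w, φ ((Mγ y).mulVec w) = Mc y * φ w := by
    intro y w
    have h := planeToComplex_inv_smul_mulVec (a := 1 + γ * (δ / τ)) (b := γ * lam * btil (ε • y))
      (by positivity) 1 w
    rw [one_mul, one_mul, Complex.ofReal_one] at h
    rw [hMγ, mul_div_assoc]
    exact h
  have hRφ : ∀ y w, φ ((R y).mulVec w) = Rc y * φ w := by
    intro y w
    have h := planeToComplex_inv_smul_mulVec (a := ε) (b := btil (ε • y) * τ)
      (by positivity) τ w
    rw [hR, ← h]
    congr 3
    · rw [add_comm]
    · rw [add_comm]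
      congr 2 <;> ring
  have hM1 : ∀ y, Mc y * (1 - γ * L y) = 1 := by
    intro y
    have hden : (((1 + γ * (δ / τ) : ℝ) : ℂ)
        + ((γ * lam * btil (ε • y) : ℝ) : ℂ) * Complex.I) ≠ 0 := by
      intro h
      have h1 := congrArg Complex.re h
      simp at h1
      have : 0 < γ * (δ / τ) := by positivity
      linarith
    have : 1 - γ * L y = (((1 + γ * (δ / τ) : ℝ) : ℂ)
        + ((γ * lam * btil (ε • y) : ℝ) : ℂ) * Complex.I) := by
      simp only [L]; push_cast; ring
    rw [this]
    exact one_div_mul_cancel hden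
  have hL : ∀ y, L y * (ε * Rc y) = -δ := by
    intro y
    have hden : ((ε : ℂ) + ((btil (ε • y) * τ : ℝ) : ℂ) * Complex.I) ≠ 0 := by
      intro h
      have h1 := congrArg Complex.re h
      simp at h1
      linarith
    have : L y = -(lam / τ) * ((ε : ℂ) + ((btil (ε • y) * τ : ℝ) : ℂ) * Complex.I) := by
      simp only [L]; push_cast; rw [hδlam]; field_simp; ring
    rw [this, hδlam]
    simp only [Rc]
    field_simp
  have hMb := fun y => norm_resolvent_le (d := δ / τ) (γ := γ) (by positivity) hγ4 hlam0 hβ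
    (hbb (ε • y))
  have hMc1 : ∀ y, ‖Mc y‖ ≤ 1 := fun y => (hMb y).1
  have hMcq : ∀ y, ‖Mc y‖ ≤ 8 / |b₀| * lam⁻¹ := fun y => (hMb y).2
  have hq0 : 0 < lam⁻¹ := by positivity
  have hMcc : ∀ y, ‖Mc y‖ ≤ c * lam⁻¹ := fun y => (hMcq y).trans (by gcongr; linarith)
  have hLM : ∀ y, ‖L y * Mc y‖ ≤ 8 := by
    intro y
    have e : (γ : ℂ) * (L y * Mc y) = Mc y - 1 := by linear_combination -hM1 y
    have h1 : γ * ‖L y * Mc y‖ ≤ 2 := by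
      rw [← Real.norm_of_nonneg hγ0.le, ← Complex.norm_real, ← norm_mul, e]
      refine (norm_sub_le _ _).trans ?_
      rw [norm_one]; linarith [hMc1 y]
    nlinarith [norm_nonneg (L y * Mc y)]
  let D : ℂ → ℂ := fun z => Rc (φ.symm z) * φ (E (φ.symm z))
  let f : ℂ → ℂ := fun z => -Complex.I / b₀ * φ (E (φ.symm z))
  have hDφ : ∀ y, D (φ y) = Rc y * φ (E y) := fun y => by simp [D]
  have hfφ : ∀ y, φ (b₀⁻¹ • (!![0, 1; -1, 0] : Matrix (Fin 2) (Fin 2) ℝ).mulVec (E y)) = f (φ y) := by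
    intro y
    simp only [φ, f, map_smul, planeToComplex_rotation, Complex.real_smul,
      LinearEquiv.symm_apply_apply]
    push_cast
    ring
  have hnE : ∀ y, ‖φ (E y)‖ ≤ κ := fun y => (norm_planeToComplex _).trans_le (hE y)
  have hDb : ∀ z, ‖D z‖ ≤ c := by
    intro z
    calc ‖D z‖ = ‖Rc (φ.symm z)‖ * ‖φ (E (φ.symm z))‖ := norm_mul _ _
      _ ≤ 2 / |b₀| * κ := by
        gcongr
        · exact norm_drift_le hτ hβ (hbb _)
        · exact hnE _
      _ ≤ c := by linarith
  have hDf : ∀ z, ‖D z - f z‖ ≤ c * ρ := by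
    intro z
    calc ‖D z - f z‖ = ‖Rc (φ.symm z) - -Complex.I / b₀‖ * ‖φ (E (φ.symm z))‖ := by
          rw [← norm_mul, sub_mul]
      _ ≤ (Q * ρ) * κ := by
        gcongr
        · rw [hQ]
          exact norm_drift_sub_le hε hτ hCb (by positivity) hb₀ (hbb _) (hb _) hε1
        · exact hnE _
      _ = (Q * κ) * ρ := by ring
      _ ≤ c * ρ := by gcongr; linarith
  have hf : ∀ y z, ‖f y - f z‖ ≤ c * ‖y - z‖ := by
    intro y z
    calc ‖f y - f z‖ = 1 / |b₀| * enorm2 (E (φ.symm y) - E (φ.symm z)) := by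
          rw [← norm_planeToComplex, map_sub, ← mul_sub, norm_mul, norm_div, norm_neg,
            Complex.norm_I, Complex.norm_real, Real.norm_eq_abs]
      _ ≤ 1 / |b₀| * (κ * enorm2 (φ.symm y - φ.symm z)) := by gcongr; exact hEL _ _
      _ = (1 / |b₀| * κ) * ‖y - z‖ := by
          rw [← norm_planeToComplex, map_sub, φ.apply_symm_apply, φ.apply_symm_apply]; ring
      _ ≤ c * ‖y - z‖ := by
        have : 1 / |b₀| * κ ≤ 2 / |b₀| * κ := by gcongr; norm_num
        gcongr
        linarith
  let r : ℕ → ℂ := fun n => φ (v n) / ε - D (φ (x n))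
  let p : ℕ → ℂ := fun n => Mc (x n) * r n
  let S : ℕ → ℂ := fun n => Mc (x2 n) * (r n + (1 - γ) * L (x n) * p n
    + (D (φ (x n)) - D (φ (x2 n))) + φ (Real.sqrt (2 * σ * δ / τ) • ξ n) / ε)
  have hv1φ : ∀ n, φ (v1 n) = ε * (D (φ (x n)) + p n) := by
    intro n
    have h := first_stage_eq (V := φ (v n)) (E := φ (E (x n))) hεC (hM1 (x n)) (hL (x n))
    rw [hv1, hMφ, map_add, map_smul, Complex.real_smul, Complex.ofReal_mul, h]
    simp only [p, r, hDφ]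
  have hFφ : ∀ n, δ * φ (F1 n) = δ * φ (E (x n)) + L (x n) * φ (v1 n) := by
    intro n
    rw [hF1, map_sub, map_add, map_smul, map_smul]
    simp only [φ, planeToComplex_rotation, Complex.real_smul, L]
    push_cast
    rw [hδlam]
    field_simp
    ring
  have hvφ : ∀ n, φ (v (n + 1)) = ε * (D (φ (x2 n)) + S n) := by
    intro n
    have h := second_stage_eq (V := φ (v n)) (E := φ (E (x n))) (E' := φ (E (x2 n))) (p := p n)
      (Z := φ (Real.sqrt (2 * σ * δ / τ) • ξ n)) hεC (hM1 (x2 n)) (hL (x n)) (hL (x2 n))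
    rw [← hDφ, ← hDφ, ← hv1φ, ← hFφ] at h
    rw [hv, hMφ, map_add, map_add, map_add, map_smul φ ((1 - γ) * δ), map_smul φ (γ * δ),
      Complex.real_smul, Complex.real_smul]
    push_cast
    rw [mul_assoc (1 - (γ : ℂ))]
    exact h
  have hp : ∀ n, ‖p n‖ ≤ c * lam⁻¹ * ‖r n‖ := by
    intro n
    rw [norm_mul]
    gcongr
    exact hMcc _
  have hS : ∀ n < N, ‖S n‖ ≤ c * lam⁻¹ * (c * ‖r n‖ + ‖D (φ (x n)) - D (φ (x2 n))‖) + c * η := by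
    intro n hn
    have h1 : ‖r n + (1 - γ) * L (x n) * p n‖ ≤ c * ‖r n‖ := by
      have e : (1 - γ : ℂ) * L (x n) * p n = ((1 - γ : ℝ) : ℂ) * ((L (x n) * Mc (x n)) * r n) := by
        simp only [p]; push_cast; ring
      have h2 : ‖(1 - γ : ℂ) * L (x n) * p n‖ ≤ 1 * (8 * ‖r n‖) := by
        rw [e, norm_mul, norm_mul, Complex.norm_real, Real.norm_of_nonneg (by linarith)]
        gcongr
        · linarith
        · exact hLM _
      calc _ ≤ ‖r n‖ + 1 * (8 * ‖r n‖) := (norm_add_le _ _).trans (by gcongr)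
        _ = 9 * ‖r n‖ := by ring
        _ ≤ _ := by gcongr
    have h3 : lam⁻¹ * ‖φ (Real.sqrt (2 * σ * δ / τ) • ξ n) / ε‖ ≤ η := by
      have hns := noise_scaling (σ := σ) (τ := τ) hε hΔ hδ
      rw [← hlam] at hns
      rw [hη, ← hns, map_smul, norm_div, norm_smul, norm_planeToComplex,
        Real.norm_of_nonneg (Real.sqrt_nonneg _), Complex.norm_real, Real.norm_of_nonneg hε.le]
      calc _ ≤ lam⁻¹ * (Real.sqrt (2 * σ * δ / τ) * Mξ / ε) := by gcongr; exact hξ n hn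
        _ = _ := by ring
    calc ‖S n‖ ≤ c * lam⁻¹ * (c * ‖r n‖ + ‖D (φ (x n)) - D (φ (x2 n))‖
          + ‖φ (Real.sqrt (2 * σ * δ / τ) • ξ n) / ε‖) := by
          rw [norm_mul]
          gcongr
          · exact hMcc _
          · refine (norm_add_le _ _).trans ?_
            gcongr
            refine (norm_add_le _ _).trans ?_
            gcongr
      _ = c * lam⁻¹ * (c * ‖r n‖ + ‖D (φ (x n)) - D (φ (x2 n))‖)
          + c * (lam⁻¹ * ‖φ (Real.sqrt (2 * σ * δ / τ) • ξ n) / ε‖) := by ring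
      _ ≤ _ := by gcongr
  have main := perturbed_two_stage_bound (c := c) (h := Δt) (q := lam⁻¹) (ρ := ρ) (η := η) (γ := γ)
    (T := T) (N := N) (by linarith) hΔ.le (by linarith) hq0.le
    (inv_le_one_of_one_le₀ (by linarith)) hρ0 hη0 hγ4 hγ1 hN
    (by rw [← div_eq_mul_inv, div_le_iff₀ hlam0]; linarith) hDf hf hDb
    (x := fun n => φ (x n)) (y := fun n => φ (x2 n)) (r := r) (p := p) (s := S)
    (u := fun n => φ (u n)) (w := fun n => φ (u1 n)) hp hS
    (fun n => by
      simp only [hx2, map_add, map_smul, hv1φ, Complex.real_smul]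
      push_cast
      rw [← hδε]
      ring)
    (fun n => by
      simp only [hx, map_add, map_smul, hv1φ, hvφ, Complex.real_smul]
      push_cast
      rw [← hδε]
      ring)
    (fun n => by
      simp only [r, hvφ]
      rw [mul_div_cancel_left₀ _ hεC]
      ring)
    (fun n => by simp only [hu1, map_add, map_smul φ (Δt / (2 * γ)), hfφ])
    (fun n => by
      simp only [hu, map_add, map_smul φ ((1 - γ) * Δt), map_smul φ (γ * Δt), hfφ])
    (by simp only [hx0, hu0])
  have hqh : lam⁻¹ * Δt = ε ^ 2 := by rw [hlam]; field_simp
  have hr0 : ‖r 0‖ = enorm2 (ε⁻¹ • v 0 - (R (x 0)).mulVec (E (x 0))) := by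
    rw [← norm_planeToComplex, map_sub, map_smul, Complex.real_smul, hRφ]
    simp only [r, hDφ]
    push_cast
    rw [div_eq_inv_mul]
  have hfin : ‖φ (x N) - φ (u N)‖ = enorm2 (x N - u N) := by
    rw [← norm_planeToComplex, map_sub]
  rw [← hfin, ← hr0, ← hqh]
  exact main
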